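/- Let R be any set of exactly r lines of PG(2,q). Then |𝒫ᵒ(R)| ≡ r(q + 2 − r) (mod 4). -/

import Mathlib

open scoped BigOperators

/-- Points (and, by self-duality of homogeneous coordinates, lines) of the
Desarguesian projective plane `PG(2,q)` over the field `F`. -/
abbrev PG (F : Type*) [Field F] := Projectivization F (Fin 3 → F)

/-- Incidence between a point and a line (the line being given by its dual
homogeneous coordinates): the dot product of representatives vanishes.
This does not depend on the choice of representatives. -/
def Incid {F : Type*} [Field F] (p l : PG F) : Prop :=
  ∑ i, p.rep i * l.rep i = 0

/-- `𝒫ᵒ(R)`: points incident with an odd number of lines of `R`. -/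
def Podd (F : Type*) [Field F] (R : Set (PG F)) : Set (PG F) :=
  {p | Odd {l ∈ R | Incid p l}.ncard}

/-- `𝒫ᵉ(R)`: points incident with an even number of lines of `R`. -/
def Peven (F : Type*) [Field F] (R : Set (PG F)) : Set (PG F) :=
  {p | Even {l ∈ R | Incid p l}.ncard}

/-- `ℒᵒ(S)`: lines meeting `S` in an odd number of points. -/
def Lodd (F : Type*) [Field F] (S : Set (PG F)) : Set (PG F) :=
  {l | Odd {p ∈ S | Incid p l}.ncard}

/-- `ℒᵉ(S)`: lines meeting `S` in an even number of points. -/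
def Leven (F : Type*) [Field F] (S : Set (PG F)) : Set (PG F) :=
  {l | Even {p ∈ S | Incid p l}.ncard}

/-- `f(r)`: the minimum size of the symmetric difference of `r` distinct lines,
i.e. the minimum of `|𝒫ᵒ(R)|` over sets `R` of exactly `r` lines. -/
noncomputable def fmin (F : Type*) [Field F] (r : ℕ) : ℕ :=
  sInf {n | ∃ R : Set (PG F), R.ncard = r ∧ (Podd F R).ncard = n}

theorem incid_iff_orthogonal {F : Type*} [Field F] (p l : PG F) :
    Incid p l ↔ Projectivization.orthogonal p l := by
  conv_rhs => rw [← p.mk_rep, ← l.mk_rep]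
  rw [Projectivization.orthogonal_mk]
  rfl

theorem card_points_on_line {F : Type*} [Field F] [Fintype F] [Fintype (PG F)]
    [DecidableRel (Incid (F := F))] (l : PG F) :
    (Finset.univ.filter fun p : PG F => Incid p l).card = Fintype.card F + 1 := by
  classical
  have h1 := Configuration.ProjectivePlane.card_points (PG F) (PG F)
  have h2 : Nat.card (PG F) = _ :=
    Projectivization.card_of_finrank F (Fin 3 → F) (n := 3) (by simp)
  rw [Nat.card_eq_fintype_card, Nat.card_eq_fintype_card, h1] at h2
  simp only [Finset.sum_range_succ, Finset.sum_range_zero, pow_zero, pow_one] at h2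
  have h3 : Configuration.ProjectivePlane.order (PG F) (PG F) = Fintype.card F := by
    nlinarith
  have h4 := Configuration.ProjectivePlane.pointCount_eq (PG F) l
  rw [h3, Configuration.pointCount, Nat.card_eq_fintype_card, Fintype.card_subtype] at h4
  rw [← h4]
  congr 1
  ext p
  simp only [Finset.mem_filter, incid_iff_orthogonal, Configuration.ofField.mem_iff]

theorem card_points_on_two_lines {F : Type*} [Field F] [Fintype F] [Fintype (PG F)]
    [DecidableRel (Incid (F := F))] (l m : PG F) (h : l ≠ m) :
    (Finset.univ.filter fun p : PG F => Incid p l ∧ Incid p m).card = 1 := by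
  classical
  obtain ⟨p, hp, hu⟩ := Configuration.HasPoints.existsUnique_point (PG F) (PG F) l m h
  rw [Finset.card_eq_one]
  refine ⟨p, ?_⟩
  ext x
  simp only [Finset.mem_filter, Finset.mem_univ, true_and, incid_iff_orthogonal,
    Finset.mem_singleton]
  exact ⟨fun hx => hu x hx, fun hx => hx ▸ hp⟩

/-- For any set `R` of exactly `r` lines, `|𝒫ᵒ(R)| ≡ r(q + 2 − r) (mod 4)`. -/
theorem stmt3 {F : Type*} [Field F] [Fintype F] (q : ℕ)
    (hcard : Fintype.card F = q) (hq : Odd q)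
    (r : ℕ) (R : Set (PG F)) (hR : R.ncard = r) :
    ((Podd F R).ncard : ℤ) ≡ (r : ℤ) * ((q : ℤ) + 2 - r) [ZMOD 4] := by
  classical
  have : Fintype (PG F) := Fintype.ofFinite _
  set S : Finset (PG F) := R.toFinset with hS
  have hSr : S.card = r := by rw [← hR, Set.ncard_eq_toFinset_card']
  let d : PG F → ℕ := fun p => (S.filter fun l => Incid p l).card
  have hd : ∀ p, {l ∈ R | Incid p l}.ncard = d p := by
    intro p
    rw [Set.ncard_eq_toFinset_card']
    congr 1
    ext l
    simp [hS]
  have hodd : (Podd F R).ncard = ∑ p : PG F, (if Odd (d p) then 1 else 0) := by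
    rw [Set.ncard_eq_toFinset_card', ← Finset.card_filter]
    congr 1
    ext p
    rw [Set.mem_toFinset, Podd, Set.mem_setOf_eq, hd, Finset.mem_filter]
    simp
  have hsum : ∑ p : PG F, (d p) ^ 2 = ∑ l ∈ S, ∑ m ∈ S, (if l = m then q + 1 else 1) := by
    have h1 : ∀ p, (d p) ^ 2 = ∑ l ∈ S, ∑ m ∈ S, (if Incid p l ∧ Incid p m then 1 else 0) := by
      intro p
      simp only [d, sq, Finset.card_filter, Finset.sum_mul_sum]
      refine Finset.sum_congr rfl fun l _ => Finset.sum_congr rfl fun m _ => ?_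
      by_cases h : Incid p l <;> by_cases h' : Incid p m <;> simp [h, h']
    simp only [h1]
    rw [Finset.sum_comm]
    refine Finset.sum_congr rfl fun l _ => ?_
    rw [Finset.sum_comm]
    refine Finset.sum_congr rfl fun m _ => ?_
    rw [← Finset.card_filter]
    split_ifs with h
    · subst h
      simp only [and_self]
      rw [card_points_on_line, hcard]
    · exact card_points_on_two_lines l m h
  have hsum2 : ∑ l ∈ S, ∑ m ∈ S, (if l = m then q + 1 else 1) = r * (q + r) := by
    rw [← hSr, ← smul_eq_mul, ← Finset.sum_const]
    refine Finset.sum_congr rfl fun l hl => ?_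
    have : ∀ m ∈ S, (if l = m then q + 1 else 1) = (if l = m then q else 0) + 1 := by
      intro m _
      split_ifs <;> rfl
    rw [Finset.sum_congr rfl this, Finset.sum_add_distrib, Finset.sum_ite_eq]
    simp [hl]
  have hmod : ((Podd F R).ncard : ℤ) ≡ ∑ p : PG F, (d p : ℤ) ^ 2 [ZMOD 4] := by
    rw [hodd]
    push_cast
    apply Int.ModEq.sum
    intro p _
    split_ifs with h
    · obtain ⟨k, hk⟩ := h
      rw [hk]
      refine (Int.modEq_iff_dvd.2 ⟨k ^ 2 + k, ?_⟩)
      push_cast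
      ring
    · obtain ⟨k, hk⟩ := Nat.not_odd_iff_even.1 h
      rw [hk]
      refine (Int.modEq_iff_dvd.2 ⟨k ^ 2, ?_⟩)
      push_cast
      ring
  have hz : ∑ p : PG F, (d p : ℤ) ^ 2 = r * (q + r) := by
    exact_mod_cast hsum.trans hsum2
  rw [hz] at hmod
  refine hmod.trans ?_
  obtain ⟨k, hk⟩ := Int.even_mul_pred_self (r : ℤ)
  refine Int.modEq_iff_dvd.2 ⟨-k, ?_⟩
  linear_combination (-2) * hk
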